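/- arXiv:2311.12963 — 3 statements merged into one kernel-verified Lean document; each statement's English description precedes it below -/
import Mathlib

section
/- (Gaschütz's Lemma) Let G be a finite group, let f : G → H be a surjective group homomorphism, and suppose n ≥ r(G). Then for every generating sequence s = (s₁,…,sₙ) ∈ Γ_n(H), there exists a generating sequence t = (t₁,…,tₙ) ∈ Γ_n(G) such that f(tᵢ) = sᵢ for all i ≤ n. -/
/-- `(x₁,…,xₙ)` is a generating sequence of `G`: the entries generate `G`. -/
def IsGenSeq {G : Type*} [Group G] {n : ℕ} (x : Fin n → G) : Prop :=
  Subgroup.closure (Set.range x) = ⊤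

/-- `r(G)`: the least `n` such that `G` has a generating sequence of length `n`. -/
noncomputable def grank (G : Type*) [Group G] : ℕ :=
  sInf {n : ℕ | ∃ x : Fin n → G, IsGenSeq x}

/-- `G` is homogeneous of rank `n`: `Γ_n(G)` is nonempty and `Aut(G)` acts
transitively on it. -/
def IsHomogeneous (G : Type*) [Group G] (n : ℕ) : Prop :=
  (∃ x : Fin n → G, IsGenSeq x) ∧
    ∀ x y : Fin n → G, IsGenSeq x → IsGenSeq y → ∃ f : G ≃* G, ∀ i, f (x i) = y i

/-- If a subgroup surjects onto `H`, then all tuples in `H` have the same number of lifts to it. -/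
theorem card_lifts_eq_of_map_eq_top {G H : Type*} [Group G] [Finite G] [Group H] {n : ℕ}
    (f : G →* H) {K : Subgroup G} (hK : K.map f = ⊤) (s s' : Fin n → H) :
    Nat.card {t : Fin n → G // (∀ i, t i ∈ K) ∧ ∀ i, f (t i) = s i} =
      Nat.card {t : Fin n → G // (∀ i, t i ∈ K) ∧ ∀ i, f (t i) = s' i} := by
  have lift (s : Fin n → H) : ∃ t : Fin n → G, ∀ i, t i ∈ K ∧ f (t i) = s i := by
    have h (i) : ∃ g, g ∈ K ∧ f g = s i := by
      rw [← Subgroup.mem_map, hK]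
      exact Subgroup.mem_top _
    choose t ht using h
    exact ⟨t, ht⟩
  obtain ⟨u, hu⟩ := lift s
  obtain ⟨v, hv⟩ := lift s'
  refine Nat.card_congr ((Equiv.mulRight (u⁻¹ * v)).subtypeEquiv fun t => ?_)
  have mem (i) : t i * ((u i)⁻¹ * v i) ∈ K ↔ t i ∈ K :=
    K.mul_mem_cancel_right (K.mul_mem (K.inv_mem (hu i).1) (hv i).1)
  have map (i) : f (t i * ((u i)⁻¹ * v i)) = s' i ↔ f (t i) = s i := by
    rw [map_mul, map_mul, map_inv, (hu i).2, (hv i).2, ← mul_assoc, mul_eq_right,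
      mul_inv_eq_one]
  simp only [Equiv.coe_mulRight, Pi.mul_apply, Pi.inv_apply, mem, map]

/-- The lifts of a tuple to a subgroup `K`, counted by the subgroup that they generate. -/
theorem card_lifts_eq_sum {G H : Type*} [Group G] [Finite G] [Group H] [Fintype (Subgroup G)]
    [DecidableLE (Subgroup G)] {n : ℕ} (f : G →* H) (K : Subgroup G) (s : Fin n → H) :
    Nat.card {t : Fin n → G // (∀ i, t i ∈ K) ∧ ∀ i, f (t i) = s i} =
      ∑ L : Subgroup G with L ≤ K,
        Nat.card {t : Fin n → G // Subgroup.closure (Set.range t) = L ∧ ∀ i, f (t i) = s i} := by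
  classical
  have := Fintype.ofFinite G
  simp only [Nat.card_eq_fintype_card, Fintype.card_subtype]
  rw [Finset.card_eq_sum_card_fiberwise (f := fun t => Subgroup.closure (Set.range t))
    (t := Finset.univ.filter (· ≤ K))]
  · refine Finset.sum_congr rfl fun L hL => congrArg Finset.card ?_
    ext t
    simp only [Finset.mem_filter, Finset.mem_univ, true_and] at hL ⊢
    constructor
    · rintro ⟨⟨-, h⟩, rfl⟩
      exact ⟨rfl, h⟩
    · rintro ⟨rfl, h⟩
      exact ⟨⟨fun i => hL (Subgroup.subset_closure ⟨i, rfl⟩), h⟩, rfl⟩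
  · intro t ht
    simp only [Finset.coe_filter, Finset.mem_univ, true_and, Set.mem_ofPred_eq] at ht ⊢
    rw [Subgroup.closure_le]
    rintro _ ⟨i, rfl⟩
    exact ht.1 i

/-- The number of lifts of a generating sequence of `H` that generate a given subgroup of `G`
does not depend on the generating sequence. -/
theorem card_generating_lifts_eq {G H : Type*} [Group G] [Finite G] [Group H] {n : ℕ}
    (f : G →* H) {s s' : Fin n → H} (hs : IsGenSeq s) (hs' : IsGenSeq s') (K : Subgroup G) :
    Nat.card {t : Fin n → G // Subgroup.closure (Set.range t) = K ∧ ∀ i, f (t i) = s i} =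
      Nat.card {t : Fin n → G // Subgroup.closure (Set.range t) = K ∧ ∀ i, f (t i) = s' i} := by
  classical
  induction K using WellFoundedLT.induction with
  | ind K ih =>
  by_cases hK : K.map f = ⊤
  · have := Fintype.ofFinite (Subgroup G)
    have hmem : K ∈ Finset.univ.filter (· ≤ K) := by simp
    have h := card_lifts_eq_of_map_eq_top f hK s s'
    rw [card_lifts_eq_sum, card_lifts_eq_sum,
      ← Finset.add_sum_erase _ _ hmem, ← Finset.add_sum_erase _ _ hmem,
      Finset.sum_congr rfl fun L hL => ih L ?_] at h
    · exact Nat.add_right_cancel h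
    · simp only [Finset.mem_erase, Finset.mem_filter] at hL
      exact lt_of_le_of_ne hL.2.2 hL.1
  · have empty {s : Fin n → H} (hs : IsGenSeq s) : IsEmpty {t : Fin n → G //
        Subgroup.closure (Set.range t) = K ∧ ∀ i, f (t i) = s i} := by
      refine ⟨fun ⟨t, ht, hts⟩ => hK ?_⟩
      have hfs : f ∘ t = s := funext hts
      rw [← ht, MonoidHom.map_closure, ← Set.range_comp, hfs]
      exact hs
    have := empty hs
    have := empty hs'
    simp

/-- A finite group has a generating sequence of every length that is at least its rank. -/
theorem exists_isGenSeq_of_grank_le {G : Type*} [Group G] [Finite G] {n : ℕ}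
    (hn : grank G ≤ n) : ∃ x : Fin n → G, IsGenSeq x := by
  have hne : {m : ℕ | ∃ x : Fin m → G, IsGenSeq x}.Nonempty :=
    ⟨Nat.card G, (Finite.equivFin G).symm, by
      rw [IsGenSeq, (Finite.equivFin G).symm.surjective.range_eq, Subgroup.closure_univ]⟩
  obtain ⟨x, hx⟩ := Nat.sInf_mem hne
  refine ⟨fun i => if h : (i : ℕ) < grank G then x ⟨i, h⟩ else 1, top_le_iff.mp ?_⟩
  rw [← (hx : Subgroup.closure (Set.range x) = ⊤)]
  refine Subgroup.closure_mono ?_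
  rintro _ ⟨i, rfl⟩
  exact ⟨⟨i, i.2.trans_le hn⟩, dif_pos i.2⟩

/-- Gaschütz's Lemma: generating sequences lift along surjections from finite groups. -/
theorem gaschutz_lemma (G H : Type*) [Group G] [Finite G] [Group H]
    (f : G →* H) (hf : Function.Surjective f) (n : ℕ) (hn : grank G ≤ n)
    (s : Fin n → H) (hs : IsGenSeq s) :
    ∃ t : Fin n → G, IsGenSeq t ∧ ∀ i, f (t i) = s i := by
  obtain ⟨x, hx⟩ := exists_isGenSeq_of_grank_le hn
  have hfx : IsGenSeq (f ∘ x) := by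
    rw [IsGenSeq, Set.range_comp, ← MonoidHom.map_closure, hx,
      Subgroup.map_top_of_surjective f hf]
  have hpos : 0 < Nat.card {t : Fin n → G //
      Subgroup.closure (Set.range t) = ⊤ ∧ ∀ i, f (t i) = (f ∘ x) i} :=
    Nat.card_pos_iff.mpr ⟨⟨⟨x, hx, fun _ => rfl⟩⟩, inferInstance⟩
  rw [card_generating_lifts_eq f hfx hs] at hpos
  obtain ⟨⟨t, ht⟩⟩ := (Nat.card_pos_iff.mp hpos).1
  exact ⟨t, ht⟩
end

section
/- Let G be a finite group and suppose n > m ≥ r(G). Then there exists a surjective homomorphism from H(n,G) onto H(m,G). -/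
/-- The intersection of the kernels of all surjective homomorphisms `F_n → G`. -/
def coverKer (n : ℕ) (G : Type*) [Group G] : Subgroup (FreeGroup (Fin n)) :=
  ⨅ f ∈ {f : FreeGroup (Fin n) →* G | Function.Surjective f}, MonoidHom.ker f

instance coverKer_normal (n : ℕ) (G : Type*) [Group G] : (coverKer n G).Normal := by
  constructor
  intro x hx g
  simp only [coverKer, Subgroup.mem_iInf] at hx ⊢
  intro f hf
  exact (MonoidHom.normal_ker f).conj_mem x (hx f hf) g

/-- The homogeneous cover `H(n,G) = F_n / K`, where `K` is the intersection of the
kernels of all surjective homomorphisms `F_n → G`. -/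
abbrev HomogeneousCover (n : ℕ) (G : Type*) [Group G] :=
  FreeGroup (Fin n) ⧸ coverKer n G

/-- Pulling back along a surjection of free groups sends one cover kernel into the other. -/
theorem coverKer_le_comap {G : Type*} [Group G] {n m : ℕ}
    (π : FreeGroup (Fin n) →* FreeGroup (Fin m)) (hπ : Function.Surjective π) :
    coverKer n G ≤ (coverKer m G).comap π := by
  intro x hx
  simp only [coverKer, Subgroup.mem_comap, Subgroup.mem_iInf] at hx ⊢
  exact fun f hf => hx (f.comp π) (hf.comp hπ)

theorem exists_surjective_freeGroup_fin {n m : ℕ} (h : m ≤ n) :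
    ∃ π : FreeGroup (Fin n) →* FreeGroup (Fin m), Function.Surjective π := by
  let ι : FreeGroup (Fin m) →* FreeGroup (Fin n) := FreeGroup.map (Fin.castLE h)
  let π : FreeGroup (Fin n) →* FreeGroup (Fin m) :=
    FreeGroup.lift fun i => if hi : (i : ℕ) < m then FreeGroup.of ⟨i, hi⟩ else 1
  have hπ : π.comp ι = MonoidHom.id _ := by
    ext i
    simp [π, ι]
  exact ⟨π, fun x => ⟨ι x, DFunLike.congr_fun hπ x⟩⟩

/-- If `n > m ≥ r(G)`, then `H(n,G)` surjects onto `H(m,G)`. -/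
theorem cover_surjects_onto_smaller_cover (G : Type*) [Group G] [Finite G] (n m : ℕ)
    (h1 : n > m) (h2 : m ≥ grank G) :
    ∃ φ : HomogeneousCover n G →* HomogeneousCover m G, Function.Surjective φ := by
  obtain ⟨π, hπ⟩ := exists_surjective_freeGroup_fin h1.le
  refine ⟨QuotientGroup.map _ _ π (coverKer_le_comap π hπ), ?_⟩
  exact QuotientGroup.map_surjective_of_surjective _ _ _
    ((QuotientGroup.mk'_surjective _).comp hπ) _
end

section
/- Let G be a finite group that can be generated by n elements. If a finite group K is a quotient of G (i.e., there is a surjective homomorphism G → K), then H(n,K) is a quotient of H(n,G), i.e., there is a surjective homomorphism H(n,G) → H(n,K). -/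
open Classical in
/-- The lifts of `y` along `f` all of whose entries lie in `H` are as many as those of `y'`,
whenever `f` maps `H` onto the codomain. -/
theorem card_lifts_le_eq {G K ι : Type*} [Group G] [Fintype G] [Group K] [Fintype ι]
    (f : G →* K) (H : Subgroup G) (hH : H.map f = ⊤) (y y' : ι → K) :
    (Finset.univ.filter fun x : ι → G =>
        Subgroup.closure (Set.range x) ≤ H ∧ ∀ i, f (x i) = y i).card =
      (Finset.univ.filter fun x : ι → G =>
        Subgroup.closure (Set.range x) ≤ H ∧ ∀ i, f (x i) = y' i).card := by
  have hlift : ∀ i, ∃ h ∈ H, f h = (y i)⁻¹ * y' i := fun i => by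
    have : (y i)⁻¹ * y' i ∈ H.map f := hH ▸ Subgroup.mem_top _
    simpa [Subgroup.mem_map] using this
  choose h hh hfh using hlift
  refine Finset.card_equiv (Equiv.mulRight h) fun x => ?_
  simp only [Finset.mem_filter, Finset.mem_univ, true_and, Subgroup.closure_le,
    Set.range_subset_iff, SetLike.mem_coe, Equiv.coe_mulRight, Pi.mul_apply, map_mul, hfh,
    Subgroup.mul_mem_cancel_right _ (hh _), ← mul_assoc]
  refine and_congr_right fun _ => forall_congr' fun i => ?_
  rw [mul_eq_right, mul_inv_eq_one]

open Classical in
/-- The number of lifts of a generating family `y` along `f` that generate a given subgroup `H`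
does not depend on `y`. -/
theorem card_lifts_closure_eq {G K ι : Type*} [Group G] [Fintype G] [Group K] [Fintype ι]
    (f : G →* K) {y y' : ι → K} (hy : Subgroup.closure (Set.range y) = ⊤)
    (hy' : Subgroup.closure (Set.range y') = ⊤) (H : Subgroup G) :
    (Finset.univ.filter fun x : ι → G =>
        Subgroup.closure (Set.range x) = H ∧ ∀ i, f (x i) = y i).card =
      (Finset.univ.filter fun x : ι → G =>
        Subgroup.closure (Set.range x) = H ∧ ∀ i, f (x i) = y' i).card := by
  induction H using WellFoundedLT.induction with
  | ind H ih =>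
  by_cases hH : H.map f = ⊤
  · have key : ∀ z : ι → K,
        (Finset.univ.filter fun x : ι → G =>
          Subgroup.closure (Set.range x) ≤ H ∧ ∀ i, f (x i) = z i).card =
        (Finset.univ.filter fun x : ι → G =>
          Subgroup.closure (Set.range x) = H ∧ ∀ i, f (x i) = z i).card +
        ∑ L ∈ Finset.univ.filter (· < H), (Finset.univ.filter fun x : ι → G =>
          Subgroup.closure (Set.range x) = L ∧ ∀ i, f (x i) = z i).card := by
      intro z
      rw [← Finset.sum_insert (s := Finset.univ.filter (· < H)) (a := H)
        (f := fun L => (Finset.univ.filter fun x : ι → G =>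
          Subgroup.closure (Set.range x) = L ∧ ∀ i, f (x i) = z i).card) (by simp),
        Finset.card_eq_sum_card_fiberwise (f := fun x : ι → G => Subgroup.closure (Set.range x))
          (t := insert H (Finset.univ.filter (· < H)))]
      · refine Finset.sum_congr rfl fun L hL => congrArg Finset.card ?_
        have hLH : L ≤ H := by
          simpa [le_iff_eq_or_lt] using hL
        ext x
        simp only [Finset.mem_filter, Finset.mem_univ, true_and]
        constructor
        · rintro ⟨⟨-, hx⟩, rfl⟩
          exact ⟨rfl, hx⟩
        · rintro ⟨rfl, hx⟩
          exact ⟨⟨hLH, hx⟩, rfl⟩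
      · intro x hx
        have hx' : Subgroup.closure (Set.range x) ≤ H := (Finset.mem_filter.mp hx).2.1
        simpa [le_iff_eq_or_lt] using hx'
    have hsum := card_lifts_le_eq f H hH y y'
    rw [key, key, Finset.sum_congr rfl fun L hL => ih L (Finset.mem_filter.mp hL).2] at hsum
    exact Nat.add_right_cancel hsum
  · have key : ∀ z : ι → K, Subgroup.closure (Set.range z) = ⊤ →
        (Finset.univ.filter fun x : ι → G =>
          Subgroup.closure (Set.range x) = H ∧ ∀ i, f (x i) = z i) = ∅ := by
      refine fun z hz => Finset.filter_eq_empty_iff.mpr ?_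
      rintro x - ⟨rfl, hx⟩
      refine hH ?_
      rw [MonoidHom.map_closure, ← Set.range_comp, show f ∘ x = z from funext hx, hz]
    rw [key y hy, key y' hy']

/-- **Gaschütz's lemma**: if a finite group `G` is generated by a family indexed by `ι`, every
generating family of a quotient of `G` indexed by `ι` lifts to a generating family of `G`. -/
theorem exists_generating_lift {G K ι : Type*} [Group G] [Finite G] [Group K] [Finite ι]
    (f : G →* K) (hf : Function.Surjective f) {x₀ : ι → G}
    (hx₀ : Subgroup.closure (Set.range x₀) = ⊤) {y : ι → K}
    (hy : Subgroup.closure (Set.range y) = ⊤) :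
    ∃ x : ι → G, Subgroup.closure (Set.range x) = ⊤ ∧ ∀ i, f (x i) = y i := by
  classical
  have := Fintype.ofFinite G
  have := Fintype.ofFinite ι
  have hfx₀ : Subgroup.closure (Set.range (f ∘ x₀)) = ⊤ := by
    rw [Set.range_comp, ← MonoidHom.map_closure, hx₀, Subgroup.map_top_of_surjective f hf]
  have hcard := card_lifts_closure_eq f hfx₀ hy ⊤
  have hpos : 0 < (Finset.univ.filter fun x : ι → G =>
      Subgroup.closure (Set.range x) = ⊤ ∧ ∀ i, f (x i) = (f ∘ x₀) i).card :=
    Finset.card_pos.mpr ⟨x₀, by simp [hx₀]⟩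
  rw [hcard] at hpos
  obtain ⟨x, hx⟩ := Finset.card_pos.mp hpos
  exact ⟨x, (Finset.mem_filter.mp hx).2⟩

/-- A homomorphism from a free group is onto iff the images of the generators generate. -/
theorem FreeGroup.surjective_iff_closure_range_of {G ι : Type*} [Group G]
    (g : FreeGroup ι →* G) :
    Function.Surjective g ↔ Subgroup.closure (Set.range fun i => g (FreeGroup.of i)) = ⊤ := by
  rw [← MonoidHom.range_eq_top, MonoidHom.range_eq_map, ← FreeGroup.closure_range_of,
    MonoidHom.map_closure, ← Set.range_comp]
  rfl

theorem coverKer_le_of_surjective {G K : Type*} [Group G] [Finite G] [Group K] {n : ℕ}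
    (hG : ∃ x : Fin n → G, IsGenSeq x) (f : G →* K) (hf : Function.Surjective f) :
    coverKer n G ≤ coverKer n K := by
  obtain ⟨x₀, hx₀⟩ := hG
  refine le_iInf₂ fun g hg w hw => ?_
  obtain ⟨x, hx, hfx⟩ := exists_generating_lift f hf hx₀
    ((FreeGroup.surjective_iff_closure_range_of g).mp hg)
  have hcomp : f.comp (FreeGroup.lift x) = g := FreeGroup.ext_hom _ _ fun i => by simp [hfx]
  have hsurj : Function.Surjective (FreeGroup.lift x) :=
    (FreeGroup.surjective_iff_closure_range_of _).mpr (by simpa using hx)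
  simp only [coverKer, Subgroup.mem_iInf] at hw
  have hlift : FreeGroup.lift x w = 1 := hw _ hsurj
  rw [MonoidHom.mem_ker, ← hcomp, MonoidHom.comp_apply, hlift, map_one]

/-- If `K` is a quotient of the `n`-generated finite group `G`, then `H(n,K)` is a
quotient of `H(n,G)`. -/
theorem cover_quotient_functorial (G K : Type*) [Group G] [Finite G] [Group K] [Finite K]
    (n : ℕ) (hG : ∃ x : Fin n → G, IsGenSeq x)
    (f : G →* K) (hf : Function.Surjective f) :
    ∃ φ : HomogeneousCover n G →* HomogeneousCover n K, Function.Surjective φ := by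
  have hle : coverKer n G ≤ (coverKer n K).comap (MonoidHom.id _) :=
    coverKer_le_of_surjective hG f hf
  exact ⟨QuotientGroup.map _ _ (MonoidHom.id _) hle,
    QuotientGroup.map_surjective_of_surjective _ _ _ (QuotientGroup.mk_surjective) hle⟩
end
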